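/- arXiv:1309.7675 — 7 statements merged into one kernel-verified Lean document; each statement's English description precedes it below -/
import Mathlib

section
/- (Proposition 3.3) Assume A₁A₂A₃ ≠ 0. Then system (3.16) has a common nontrivial rational solution (X₀,Y₀,Z₀,W₀,M₀,N₀) if and only if the equation F(x,y,z) = 0 has a nontrivial rational solution. -/
noncomputable section

/-- The general cubic plane form `F(x,y,z)` with rational coefficients. -/
def cubicF {K : Type*} [Field K] (A₁ A₂ A₃ A₄ A₅ A₆ A₇ A₈ A₉ A₁₀ : ℚ) (x y z : K) : K :=
  (A₁ : K) * x ^ 3 + (A₂ : K) * y ^ 3 + (A₃ : K) * z ^ 3 + (A₄ : K) * x ^ 2 * y +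
    (A₅ : K) * x ^ 2 * z + (A₆ : K) * y ^ 2 * x + (A₇ : K) * y ^ 2 * z +
    (A₈ : K) * z ^ 2 * x + (A₉ : K) * z ^ 2 * y + (A₁₀ : K) * x * y * z

/-- The quadratic form `F_x` obtained from `x·F` via the substitution
`X = x², Y = y², Z = z², W = xy, M = xz, N = yz`. -/
def quadFx {K : Type*} [Field K] (A₁ A₂ A₃ A₄ A₅ A₆ A₇ A₈ A₉ A₁₀ : ℚ) (X Y Z W M N : K) : K :=
  (A₁ : K) * X ^ 2 + (A₂ : K) * Y * W + (A₃ : K) * Z * M + (A₄ : K) * X * W +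
    (A₅ : K) * X * M + (A₆ : K) * X * Y + (A₇ : K) * Y * M + (A₈ : K) * X * Z +
    (A₉ : K) * Z * W + (A₁₀ : K) * X * N

/-- The quadratic form `F_y`. -/
def quadFy {K : Type*} [Field K] (A₁ A₂ A₃ A₄ A₅ A₆ A₇ A₈ A₉ A₁₀ : ℚ) (X Y Z W M N : K) : K :=
  (A₁ : K) * X * W + (A₂ : K) * Y ^ 2 + (A₃ : K) * Z * N + (A₄ : K) * X * Y +
    (A₅ : K) * X * N + (A₆ : K) * Y * W + (A₇ : K) * Y * N + (A₈ : K) * Z * W +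
    (A₉ : K) * Y * Z + (A₁₀ : K) * Y * M

/-- The quadratic form `F_z`. -/
def quadFz {K : Type*} [Field K] (A₁ A₂ A₃ A₄ A₅ A₆ A₇ A₈ A₉ A₁₀ : ℚ) (X Y Z W M N : K) : K :=
  (A₁ : K) * X * M + (A₂ : K) * Y * N + (A₃ : K) * Z ^ 2 + (A₄ : K) * X * N +
    (A₅ : K) * X * Z + (A₆ : K) * Y * M + (A₇ : K) * Y * Z + (A₈ : K) * Z * M +
    (A₉ : K) * Z * N + (A₁₀ : K) * Z * W

/-- System (3.16). -/
def sys316 {K : Type*} [Field K] (A₁ A₂ A₃ A₄ A₅ A₆ A₇ A₈ A₉ A₁₀ : ℚ) (X Y Z W M N : K) : Prop :=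
  quadFx A₁ A₂ A₃ A₄ A₅ A₆ A₇ A₈ A₉ A₁₀ X Y Z W M N = 0 ∧
    quadFy A₁ A₂ A₃ A₄ A₅ A₆ A₇ A₈ A₉ A₁₀ X Y Z W M N = 0 ∧
    quadFz A₁ A₂ A₃ A₄ A₅ A₆ A₇ A₈ A₉ A₁₀ X Y Z W M N = 0 ∧
    W * M - X * N = 0 ∧ M * N - Z * W = 0 ∧ W * N - Y * M = 0 ∧
    W ^ 2 - X * Y = 0 ∧ M ^ 2 - X * Z = 0 ∧ N ^ 2 - Y * Z = 0

theorem prop_3_3 (A₁ A₂ A₃ A₄ A₅ A₆ A₇ A₈ A₉ A₁₀ : ℚ) (hA : A₁ * A₂ * A₃ ≠ 0) :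
    (∃ X₀ Y₀ Z₀ W₀ M₀ N₀ : ℚ,
        (X₀ ≠ 0 ∨ Y₀ ≠ 0 ∨ Z₀ ≠ 0 ∨ W₀ ≠ 0 ∨ M₀ ≠ 0 ∨ N₀ ≠ 0) ∧
        sys316 A₁ A₂ A₃ A₄ A₅ A₆ A₇ A₈ A₉ A₁₀ X₀ Y₀ Z₀ W₀ M₀ N₀) ↔
      (∃ x y z : ℚ, (x ≠ 0 ∨ y ≠ 0 ∨ z ≠ 0) ∧ cubicF A₁ A₂ A₃ A₄ A₅ A₆ A₇ A₈ A₉ A₁₀ x y z = 0) := by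
  constructor
  · rintro ⟨X, Y, Z, W, M, N, hne, hFx, hFy, hFz, hWM, hMN, hWN, hW, hM, hN⟩
    by_cases hX : X = 0
    · by_cases hY : Y = 0
      · have hZ : Z ≠ 0 := by
          rintro rfl
          simp_all
        refine ⟨M, N, Z, Or.inr (Or.inr hZ), ?_⟩
        simp only [cubicF, quadFz, Rat.cast_id] at hFz ⊢
        linear_combination Z * hFz + (A₁ * M + A₄ * N + A₅ * Z) * hM +
          (A₂ * N + A₆ * M + A₇ * Z) * hN + A₁₀ * Z * hMN
      · refine ⟨W, Y, N, Or.inr (Or.inl hY), ?_⟩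
        simp only [cubicF, quadFy, Rat.cast_id] at hFy ⊢
        linear_combination Y * hFy + (A₁ * W + A₄ * Y + A₅ * N) * hW +
          (A₃ * N + A₈ * W + A₉ * Y) * hN + A₁₀ * Y * hWN
    · refine ⟨X, W, M, Or.inl hX, ?_⟩
      simp only [cubicF, quadFx, Rat.cast_id] at hFx ⊢
      linear_combination X * hFx + (A₂ * W + A₆ * X + A₇ * M) * hW +
        (A₃ * M + A₈ * X + A₉ * W) * hM + A₁₀ * X * hWM
  · rintro ⟨x, y, z, hne, hF⟩
    simp only [cubicF, Rat.cast_id] at hF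
    refine ⟨x ^ 2, y ^ 2, z ^ 2, x * y, x * z, y * z, ?_, ?_, ?_, ?_, by ring, by ring, by ring,
      by ring, by ring, by ring⟩
    · rcases hne with h | h | h <;> simp [h]
    · simp only [quadFx, Rat.cast_id]
      linear_combination x * hF
    · simp only [quadFy, Rat.cast_id]
      linear_combination y * hF
    · simp only [quadFz, Rat.cast_id]
      linear_combination z * hF
end
end

section
/- (Remark 3.4) Assume A₁A₂A₃ ≠ 0. Then: (i) F = 0 has a nontrivial rational solution (x₀,y₀,z₀) with x₀ ≠ 0 if and only if the system obtained from system (3.16) by deleting the equations F_y = 0 and F_z = 0 has a nontrivial rational solution (X₀,Y₀,Z₀,W₀,M₀,N₀) with X₀ ≠ 0; (ii) F = 0 has a nontrivial rational solution with y₀ ≠ 0 if and only if the system obtained from (3.16) by deleting F_x = 0 and F_z = 0 has a nontrivial rational solution with Y₀ ≠ 0; (iii) F = 0 has a nontrivial rational solution with z₀ ≠ 0 if and only if the system obtained from (3.16) by deleting F_x = 0 and F_y = 0 has a nontrivial rational solution with Z₀ ≠ 0. -/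
noncomputable section

/-- On the locus cut out by the Veronese relations, `F(X, W, M)` equals `X * F_x`. -/
theorem cubicF_eq_mul_quadFx {K : Type*} [Field K] (A₁ A₂ A₃ A₄ A₅ A₆ A₇ A₈ A₉ A₁₀ : ℚ)
    {X Y Z W M N : K} (hW : W ^ 2 - X * Y = 0) (hM : M ^ 2 - X * Z = 0)
    (h : W * M - X * N = 0) :
    cubicF A₁ A₂ A₃ A₄ A₅ A₆ A₇ A₈ A₉ A₁₀ X W M =
      X * quadFx A₁ A₂ A₃ A₄ A₅ A₆ A₇ A₈ A₉ A₁₀ X Y Z W M N := by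
  unfold cubicF quadFx
  linear_combination
    (A₂ : K) * W * hW + (A₃ : K) * M * hM + (A₆ : K) * X * hW + (A₇ : K) * M * hW +
      (A₈ : K) * X * hM + (A₉ : K) * W * hM + (A₁₀ : K) * X * h

/-- At the Veronese image of `(x, y, z)`, the form `F_x` equals `x * F(x, y, z)`. -/
theorem quadFx_veronese {K : Type*} [Field K] (A₁ A₂ A₃ A₄ A₅ A₆ A₇ A₈ A₉ A₁₀ : ℚ) (x y z : K) :
    quadFx A₁ A₂ A₃ A₄ A₅ A₆ A₇ A₈ A₉ A₁₀ (x ^ 2) (y ^ 2) (z ^ 2) (x * y) (x * z) (y * z) =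
      x * cubicF A₁ A₂ A₃ A₄ A₅ A₆ A₇ A₈ A₉ A₁₀ x y z := by
  unfold cubicF quadFx
  ring

/-- On the locus cut out by the Veronese relations, `F(W, Y, N)` equals `Y * F_y`. -/
theorem cubicF_eq_mul_quadFy {K : Type*} [Field K] (A₁ A₂ A₃ A₄ A₅ A₆ A₇ A₈ A₉ A₁₀ : ℚ)
    {X Y Z W M N : K} (hW : W ^ 2 - X * Y = 0) (hN : N ^ 2 - Y * Z = 0)
    (h : W * N - Y * M = 0) :
    cubicF A₁ A₂ A₃ A₄ A₅ A₆ A₇ A₈ A₉ A₁₀ W Y N =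
      Y * quadFy A₁ A₂ A₃ A₄ A₅ A₆ A₇ A₈ A₉ A₁₀ X Y Z W M N := by
  unfold cubicF quadFy
  linear_combination
    (A₁ : K) * W * hW + (A₃ : K) * N * hN + (A₄ : K) * Y * hW + (A₅ : K) * N * hW +
      (A₈ : K) * W * hN + (A₉ : K) * Y * hN + (A₁₀ : K) * Y * h

/-- At the Veronese image of `(x, y, z)`, the form `F_y` equals `y * F(x, y, z)`. -/
theorem quadFy_veronese {K : Type*} [Field K] (A₁ A₂ A₃ A₄ A₅ A₆ A₇ A₈ A₉ A₁₀ : ℚ) (x y z : K) :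
    quadFy A₁ A₂ A₃ A₄ A₅ A₆ A₇ A₈ A₉ A₁₀ (x ^ 2) (y ^ 2) (z ^ 2) (x * y) (x * z) (y * z) =
      y * cubicF A₁ A₂ A₃ A₄ A₅ A₆ A₇ A₈ A₉ A₁₀ x y z := by
  unfold cubicF quadFy
  ring

/-- On the locus cut out by the Veronese relations, `F(M, N, Z)` equals `Z * F_z`. -/
theorem cubicF_eq_mul_quadFz {K : Type*} [Field K] (A₁ A₂ A₃ A₄ A₅ A₆ A₇ A₈ A₉ A₁₀ : ℚ)
    {X Y Z W M N : K} (hM : M ^ 2 - X * Z = 0) (hN : N ^ 2 - Y * Z = 0)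
    (h : M * N - Z * W = 0) :
    cubicF A₁ A₂ A₃ A₄ A₅ A₆ A₇ A₈ A₉ A₁₀ M N Z =
      Z * quadFz A₁ A₂ A₃ A₄ A₅ A₆ A₇ A₈ A₉ A₁₀ X Y Z W M N := by
  unfold cubicF quadFz
  linear_combination
    (A₁ : K) * M * hM + (A₂ : K) * N * hN + (A₄ : K) * N * hM + (A₅ : K) * Z * hM +
      (A₆ : K) * M * hN + (A₇ : K) * Z * hN + (A₁₀ : K) * Z * h

/-- At the Veronese image of `(x, y, z)`, the form `F_z` equals `z * F(x, y, z)`. -/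
theorem quadFz_veronese {K : Type*} [Field K] (A₁ A₂ A₃ A₄ A₅ A₆ A₇ A₈ A₉ A₁₀ : ℚ) (x y z : K) :
    quadFz A₁ A₂ A₃ A₄ A₅ A₆ A₇ A₈ A₉ A₁₀ (x ^ 2) (y ^ 2) (z ^ 2) (x * y) (x * z) (y * z) =
      z * cubicF A₁ A₂ A₃ A₄ A₅ A₆ A₇ A₈ A₉ A₁₀ x y z := by
  unfold cubicF quadFz
  ring


theorem remark_3_4 (A₁ A₂ A₃ A₄ A₅ A₆ A₇ A₈ A₉ A₁₀ : ℚ) (hA : A₁ * A₂ * A₃ ≠ 0) :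
    ((∃ x₀ y₀ z₀ : ℚ, x₀ ≠ 0 ∧ (x₀ ≠ 0 ∨ y₀ ≠ 0 ∨ z₀ ≠ 0) ∧ cubicF A₁ A₂ A₃ A₄ A₅ A₆ A₇ A₈ A₉ A₁₀ x₀ y₀ z₀ = 0) ↔
      (∃ X₀ Y₀ Z₀ W₀ M₀ N₀ : ℚ, X₀ ≠ 0 ∧
        (X₀ ≠ 0 ∨ Y₀ ≠ 0 ∨ Z₀ ≠ 0 ∨ W₀ ≠ 0 ∨ M₀ ≠ 0 ∨ N₀ ≠ 0) ∧
        (quadFx A₁ A₂ A₃ A₄ A₅ A₆ A₇ A₈ A₉ A₁₀ X₀ Y₀ Z₀ W₀ M₀ N₀ = 0 ∧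
          W₀ * M₀ - X₀ * N₀ = 0 ∧ M₀ * N₀ - Z₀ * W₀ = 0 ∧ W₀ * N₀ - Y₀ * M₀ = 0 ∧
          W₀ ^ 2 - X₀ * Y₀ = 0 ∧ M₀ ^ 2 - X₀ * Z₀ = 0 ∧ N₀ ^ 2 - Y₀ * Z₀ = 0))) ∧
    ((∃ x₀ y₀ z₀ : ℚ, y₀ ≠ 0 ∧ (x₀ ≠ 0 ∨ y₀ ≠ 0 ∨ z₀ ≠ 0) ∧ cubicF A₁ A₂ A₃ A₄ A₅ A₆ A₇ A₈ A₉ A₁₀ x₀ y₀ z₀ = 0) ↔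
      (∃ X₀ Y₀ Z₀ W₀ M₀ N₀ : ℚ, Y₀ ≠ 0 ∧
        (X₀ ≠ 0 ∨ Y₀ ≠ 0 ∨ Z₀ ≠ 0 ∨ W₀ ≠ 0 ∨ M₀ ≠ 0 ∨ N₀ ≠ 0) ∧
        (quadFy A₁ A₂ A₃ A₄ A₅ A₆ A₇ A₈ A₉ A₁₀ X₀ Y₀ Z₀ W₀ M₀ N₀ = 0 ∧
          W₀ * M₀ - X₀ * N₀ = 0 ∧ M₀ * N₀ - Z₀ * W₀ = 0 ∧ W₀ * N₀ - Y₀ * M₀ = 0 ∧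
          W₀ ^ 2 - X₀ * Y₀ = 0 ∧ M₀ ^ 2 - X₀ * Z₀ = 0 ∧ N₀ ^ 2 - Y₀ * Z₀ = 0))) ∧
    ((∃ x₀ y₀ z₀ : ℚ, z₀ ≠ 0 ∧ (x₀ ≠ 0 ∨ y₀ ≠ 0 ∨ z₀ ≠ 0) ∧ cubicF A₁ A₂ A₃ A₄ A₅ A₆ A₇ A₈ A₉ A₁₀ x₀ y₀ z₀ = 0) ↔
      (∃ X₀ Y₀ Z₀ W₀ M₀ N₀ : ℚ, Z₀ ≠ 0 ∧
        (X₀ ≠ 0 ∨ Y₀ ≠ 0 ∨ Z₀ ≠ 0 ∨ W₀ ≠ 0 ∨ M₀ ≠ 0 ∨ N₀ ≠ 0) ∧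
        (quadFz A₁ A₂ A₃ A₄ A₅ A₆ A₇ A₈ A₉ A₁₀ X₀ Y₀ Z₀ W₀ M₀ N₀ = 0 ∧
          W₀ * M₀ - X₀ * N₀ = 0 ∧ M₀ * N₀ - Z₀ * W₀ = 0 ∧ W₀ * N₀ - Y₀ * M₀ = 0 ∧
          W₀ ^ 2 - X₀ * Y₀ = 0 ∧ M₀ ^ 2 - X₀ * Z₀ = 0 ∧ N₀ ^ 2 - Y₀ * Z₀ = 0))) := by
  refine ⟨?_, ?_, ?_⟩
  · constructor
    · rintro ⟨x, y, z, hx, -, hF⟩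
      have hx2 : x ^ 2 ≠ 0 := pow_ne_zero 2 hx
      refine ⟨x ^ 2, y ^ 2, z ^ 2, x * y, x * z, y * z, hx2, by tauto, ?_,
        by ring, by ring, by ring, by ring, by ring, by ring⟩
      rw [quadFx_veronese, hF, mul_zero]
    · rintro ⟨X, Y, Z, W, M, N, hX, -, hF, hWM, -, -, hW, hM, -⟩
      refine ⟨X, W, M, hX, by tauto, ?_⟩
      rw [cubicF_eq_mul_quadFx _ _ _ _ _ _ _ _ _ _ hW hM hWM, hF, mul_zero]
  · constructor
    · rintro ⟨x, y, z, hy, -, hF⟩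
      have hy2 : y ^ 2 ≠ 0 := pow_ne_zero 2 hy
      refine ⟨x ^ 2, y ^ 2, z ^ 2, x * y, x * z, y * z, hy2, by tauto, ?_,
        by ring, by ring, by ring, by ring, by ring, by ring⟩
      rw [quadFy_veronese, hF, mul_zero]
    · rintro ⟨X, Y, Z, W, M, N, hY, -, hF, -, -, hWN, hW, -, hN⟩
      refine ⟨W, Y, N, hY, by tauto, ?_⟩
      rw [cubicF_eq_mul_quadFy _ _ _ _ _ _ _ _ _ _ hW hN hWN, hF, mul_zero]
  · constructor
    · rintro ⟨x, y, z, hz, -, hF⟩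
      have hz2 : z ^ 2 ≠ 0 := pow_ne_zero 2 hz
      refine ⟨x ^ 2, y ^ 2, z ^ 2, x * y, x * z, y * z, hz2, by tauto, ?_,
        by ring, by ring, by ring, by ring, by ring, by ring⟩
      rw [quadFz_veronese, hF, mul_zero]
    · rintro ⟨X, Y, Z, W, M, N, hZ, -, hF, -, hMN, -, -, hM, hN⟩
      refine ⟨M, N, Z, hZ, by tauto, ?_⟩
      rw [cubicF_eq_mul_quadFz _ _ _ _ _ _ _ _ _ _ hM hN hMN, hF, mul_zero]
end
end

section
/- (Proposition 3.5) System (3.16) has a common nontrivial rational solution (X₀,Y₀,Z₀,W₀,M₀,N₀) with X₀Y₀Z₀ ≠ 0 if and only if the system obtained from (3.16) by deleting the equation W² − XY = 0 has a common nontrivial rational solution with X₀Y₀Z₀ ≠ 0. The same equivalence holds when the deleted equation is M² − XZ = 0, and also when it is N² − YZ = 0. -/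
noncomputable section

/-- If `r ^ 2 = u * q`, `s ^ 2 = v * q` and `r * s = q * p` with `q ≠ 0`, then `p ^ 2 = u * v`. -/
theorem sq_sub_mul_eq_zero_of_mul_eq {K : Type*} [Field K] {p q r s u v : K} (hq : q ≠ 0)
    (hrs : r * s = q * p) (hr : r ^ 2 = u * q) (hs : s ^ 2 = v * q) : p ^ 2 - u * v = 0 := by
  have h : q ^ 2 * (p ^ 2 - u * v) = 0 := by
    linear_combination (-(r * s) - q * p) * hrs + s ^ 2 * hr + u * q * hs
  exact (mul_eq_zero.mp h).resolve_left (pow_ne_zero 2 hq)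

theorem prop_3_5 (A₁ A₂ A₃ A₄ A₅ A₆ A₇ A₈ A₉ A₁₀ : ℚ) :
    ((∃ X₀ Y₀ Z₀ W₀ M₀ N₀ : ℚ, X₀ * Y₀ * Z₀ ≠ 0 ∧
        (X₀ ≠ 0 ∨ Y₀ ≠ 0 ∨ Z₀ ≠ 0 ∨ W₀ ≠ 0 ∨ M₀ ≠ 0 ∨ N₀ ≠ 0) ∧
        quadFx A₁ A₂ A₃ A₄ A₅ A₆ A₇ A₈ A₉ A₁₀ X₀ Y₀ Z₀ W₀ M₀ N₀ = 0 ∧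
        quadFy A₁ A₂ A₃ A₄ A₅ A₆ A₇ A₈ A₉ A₁₀ X₀ Y₀ Z₀ W₀ M₀ N₀ = 0 ∧
        quadFz A₁ A₂ A₃ A₄ A₅ A₆ A₇ A₈ A₉ A₁₀ X₀ Y₀ Z₀ W₀ M₀ N₀ = 0 ∧
        W₀ * M₀ - X₀ * N₀ = 0 ∧ M₀ * N₀ - Z₀ * W₀ = 0 ∧ W₀ * N₀ - Y₀ * M₀ = 0 ∧
        W₀ ^ 2 - X₀ * Y₀ = 0 ∧ M₀ ^ 2 - X₀ * Z₀ = 0 ∧ N₀ ^ 2 - Y₀ * Z₀ = 0) ↔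
      (∃ X₀ Y₀ Z₀ W₀ M₀ N₀ : ℚ, X₀ * Y₀ * Z₀ ≠ 0 ∧
        (X₀ ≠ 0 ∨ Y₀ ≠ 0 ∨ Z₀ ≠ 0 ∨ W₀ ≠ 0 ∨ M₀ ≠ 0 ∨ N₀ ≠ 0) ∧
        quadFx A₁ A₂ A₃ A₄ A₅ A₆ A₇ A₈ A₉ A₁₀ X₀ Y₀ Z₀ W₀ M₀ N₀ = 0 ∧
        quadFy A₁ A₂ A₃ A₄ A₅ A₆ A₇ A₈ A₉ A₁₀ X₀ Y₀ Z₀ W₀ M₀ N₀ = 0 ∧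
        quadFz A₁ A₂ A₃ A₄ A₅ A₆ A₇ A₈ A₉ A₁₀ X₀ Y₀ Z₀ W₀ M₀ N₀ = 0 ∧
        W₀ * M₀ - X₀ * N₀ = 0 ∧ M₀ * N₀ - Z₀ * W₀ = 0 ∧ W₀ * N₀ - Y₀ * M₀ = 0 ∧
        M₀ ^ 2 - X₀ * Z₀ = 0 ∧ N₀ ^ 2 - Y₀ * Z₀ = 0)) ∧
    ((∃ X₀ Y₀ Z₀ W₀ M₀ N₀ : ℚ, X₀ * Y₀ * Z₀ ≠ 0 ∧
        (X₀ ≠ 0 ∨ Y₀ ≠ 0 ∨ Z₀ ≠ 0 ∨ W₀ ≠ 0 ∨ M₀ ≠ 0 ∨ N₀ ≠ 0) ∧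
        quadFx A₁ A₂ A₃ A₄ A₅ A₆ A₇ A₈ A₉ A₁₀ X₀ Y₀ Z₀ W₀ M₀ N₀ = 0 ∧
        quadFy A₁ A₂ A₃ A₄ A₅ A₆ A₇ A₈ A₉ A₁₀ X₀ Y₀ Z₀ W₀ M₀ N₀ = 0 ∧
        quadFz A₁ A₂ A₃ A₄ A₅ A₆ A₇ A₈ A₉ A₁₀ X₀ Y₀ Z₀ W₀ M₀ N₀ = 0 ∧
        W₀ * M₀ - X₀ * N₀ = 0 ∧ M₀ * N₀ - Z₀ * W₀ = 0 ∧ W₀ * N₀ - Y₀ * M₀ = 0 ∧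
        W₀ ^ 2 - X₀ * Y₀ = 0 ∧ M₀ ^ 2 - X₀ * Z₀ = 0 ∧ N₀ ^ 2 - Y₀ * Z₀ = 0) ↔
      (∃ X₀ Y₀ Z₀ W₀ M₀ N₀ : ℚ, X₀ * Y₀ * Z₀ ≠ 0 ∧
        (X₀ ≠ 0 ∨ Y₀ ≠ 0 ∨ Z₀ ≠ 0 ∨ W₀ ≠ 0 ∨ M₀ ≠ 0 ∨ N₀ ≠ 0) ∧
        quadFx A₁ A₂ A₃ A₄ A₅ A₆ A₇ A₈ A₉ A₁₀ X₀ Y₀ Z₀ W₀ M₀ N₀ = 0 ∧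
        quadFy A₁ A₂ A₃ A₄ A₅ A₆ A₇ A₈ A₉ A₁₀ X₀ Y₀ Z₀ W₀ M₀ N₀ = 0 ∧
        quadFz A₁ A₂ A₃ A₄ A₅ A₆ A₇ A₈ A₉ A₁₀ X₀ Y₀ Z₀ W₀ M₀ N₀ = 0 ∧
        W₀ * M₀ - X₀ * N₀ = 0 ∧ M₀ * N₀ - Z₀ * W₀ = 0 ∧ W₀ * N₀ - Y₀ * M₀ = 0 ∧
        W₀ ^ 2 - X₀ * Y₀ = 0 ∧ N₀ ^ 2 - Y₀ * Z₀ = 0)) ∧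
    ((∃ X₀ Y₀ Z₀ W₀ M₀ N₀ : ℚ, X₀ * Y₀ * Z₀ ≠ 0 ∧
        (X₀ ≠ 0 ∨ Y₀ ≠ 0 ∨ Z₀ ≠ 0 ∨ W₀ ≠ 0 ∨ M₀ ≠ 0 ∨ N₀ ≠ 0) ∧
        quadFx A₁ A₂ A₃ A₄ A₅ A₆ A₇ A₈ A₉ A₁₀ X₀ Y₀ Z₀ W₀ M₀ N₀ = 0 ∧
        quadFy A₁ A₂ A₃ A₄ A₅ A₆ A₇ A₈ A₉ A₁₀ X₀ Y₀ Z₀ W₀ M₀ N₀ = 0 ∧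
        quadFz A₁ A₂ A₃ A₄ A₅ A₆ A₇ A₈ A₉ A₁₀ X₀ Y₀ Z₀ W₀ M₀ N₀ = 0 ∧
        W₀ * M₀ - X₀ * N₀ = 0 ∧ M₀ * N₀ - Z₀ * W₀ = 0 ∧ W₀ * N₀ - Y₀ * M₀ = 0 ∧
        W₀ ^ 2 - X₀ * Y₀ = 0 ∧ M₀ ^ 2 - X₀ * Z₀ = 0 ∧ N₀ ^ 2 - Y₀ * Z₀ = 0) ↔
      (∃ X₀ Y₀ Z₀ W₀ M₀ N₀ : ℚ, X₀ * Y₀ * Z₀ ≠ 0 ∧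
        (X₀ ≠ 0 ∨ Y₀ ≠ 0 ∨ Z₀ ≠ 0 ∨ W₀ ≠ 0 ∨ M₀ ≠ 0 ∨ N₀ ≠ 0) ∧
        quadFx A₁ A₂ A₃ A₄ A₅ A₆ A₇ A₈ A₉ A₁₀ X₀ Y₀ Z₀ W₀ M₀ N₀ = 0 ∧
        quadFy A₁ A₂ A₃ A₄ A₅ A₆ A₇ A₈ A₉ A₁₀ X₀ Y₀ Z₀ W₀ M₀ N₀ = 0 ∧
        quadFz A₁ A₂ A₃ A₄ A₅ A₆ A₇ A₈ A₉ A₁₀ X₀ Y₀ Z₀ W₀ M₀ N₀ = 0 ∧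
        W₀ * M₀ - X₀ * N₀ = 0 ∧ M₀ * N₀ - Z₀ * W₀ = 0 ∧ W₀ * N₀ - Y₀ * M₀ = 0 ∧
        W₀ ^ 2 - X₀ * Y₀ = 0 ∧ M₀ ^ 2 - X₀ * Z₀ = 0)) := by
  refine ⟨⟨?_, ?_⟩, ⟨?_, ?_⟩, ⟨?_, ?_⟩⟩
  · rintro ⟨X, Y, Z, W, M, N, h0, hne, hx, hy, hz, h1, h2, h3, -, hM, hN⟩
    exact ⟨X, Y, Z, W, M, N, h0, hne, hx, hy, hz, h1, h2, h3, hM, hN⟩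
  · rintro ⟨X, Y, Z, W, M, N, h0, hne, hx, hy, hz, h1, h2, h3, hM, hN⟩
    refine ⟨X, Y, Z, W, M, N, h0, hne, hx, hy, hz, h1, h2, h3, ?_, hM, hN⟩
    exact sq_sub_mul_eq_zero_of_mul_eq (right_ne_zero_of_mul h0) (sub_eq_zero.mp h2)
      (sub_eq_zero.mp hM) (sub_eq_zero.mp hN)
  · rintro ⟨X, Y, Z, W, M, N, h0, hne, hx, hy, hz, h1, h2, h3, hW, -, hN⟩
    exact ⟨X, Y, Z, W, M, N, h0, hne, hx, hy, hz, h1, h2, h3, hW, hN⟩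
  · rintro ⟨X, Y, Z, W, M, N, h0, hne, hx, hy, hz, h1, h2, h3, hW, hN⟩
    refine ⟨X, Y, Z, W, M, N, h0, hne, hx, hy, hz, h1, h2, h3, hW, ?_, hN⟩
    exact sq_sub_mul_eq_zero_of_mul_eq (right_ne_zero_of_mul (left_ne_zero_of_mul h0))
      (sub_eq_zero.mp h3) (sub_eq_zero.mp hW) (by linear_combination hN)
  · rintro ⟨X, Y, Z, W, M, N, h0, hne, hx, hy, hz, h1, h2, h3, hW, hM, -⟩
    exact ⟨X, Y, Z, W, M, N, h0, hne, hx, hy, hz, h1, h2, h3, hW, hM⟩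
  · rintro ⟨X, Y, Z, W, M, N, h0, hne, hx, hy, hz, h1, h2, h3, hW, hM⟩
    refine ⟨X, Y, Z, W, M, N, h0, hne, hx, hy, hz, h1, h2, h3, hW, hM, ?_⟩
    exact sq_sub_mul_eq_zero_of_mul_eq (left_ne_zero_of_mul (left_ne_zero_of_mul h0))
      (sub_eq_zero.mp h1) (by linear_combination hW) (by linear_combination hM)
end
end

section
/- (Explicit form of Proposition 3.11: the diagonal cubic maps to the curve Y² = X³ − 432(A₁A₂A₃)²) Let K be a field, let a, b, c ∈ K be nonzero, and let α, β ∈ K satisfy α³ = a and β³ = b. Suppose (x, y, z) ∈ K³ satisfies a·x³ + b·y³ + c·z³ = 0 and αx + βy ≠ 0. Define X = −12·c·α²·β²·z/(αx + βy) and Y = −36·a·b·c·(αx − βy)/(αx + βy). Then Y² = X³ − 432·(abc)². -/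
noncomputable section

theorem prop_3_11_explicit {K : Type*} [Field K] (a b c : K)
    (ha : a ≠ 0) (hb : b ≠ 0) (hc : c ≠ 0)
    (α β : K) (hα : α ^ 3 = a) (hβ : β ^ 3 = b)
    (x y z : K) (hsol : a * x ^ 3 + b * y ^ 3 + c * z ^ 3 = 0)
    (hden : α * x + β * y ≠ 0)
    (X Y : K)
    (hX : X = -12 * c * α ^ 2 * β ^ 2 * z / (α * x + β * y))
    (hY : Y = -36 * a * b * c * (α * x - β * y) / (α * x + β * y)) :
    Y ^ 2 = X ^ 3 - 432 * (a * b * c) ^ 2 := by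
  have hX' : X * (α * x + β * y) = -12 * c * α ^ 2 * β ^ 2 * z := by
    rw [hX, div_mul_cancel₀ _ hden]
  have hY' : Y * (α * x + β * y) = -36 * a * b * c * (α * x - β * y) := by
    rw [hY, div_mul_cancel₀ _ hden]
  have hX3 := congrArg (· ^ 3) hX'
  have hY2 := congrArg (· ^ 2) hY'
  subst hα hβ
  apply mul_right_cancel₀ (pow_ne_zero 3 hden)
  linear_combination (α * x + β * y) * hY2 - hX3 + 1728 * (α ^ 3 * β ^ 3 * c) ^ 2 * hsol
end
end

section
/- (Step in the proof of Proposition 3.3) Assume A₁A₂A₃ ≠ 0. If (X₀,Y₀,Z₀,W₀,M₀,N₀) ∈ ℚ⁶ is a common nontrivial rational solution of system (3.16), then at least two of the three components X₀, Y₀, Z₀ are nonzero. -/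
noncomputable section

theorem step_prop_3_3 (A₁ A₂ A₃ A₄ A₅ A₆ A₇ A₈ A₉ A₁₀ : ℚ) (hA : A₁ * A₂ * A₃ ≠ 0)
    (X₀ Y₀ Z₀ W₀ M₀ N₀ : ℚ)
    (hnt : X₀ ≠ 0 ∨ Y₀ ≠ 0 ∨ Z₀ ≠ 0 ∨ W₀ ≠ 0 ∨ M₀ ≠ 0 ∨ N₀ ≠ 0)
    (hsol : sys316 A₁ A₂ A₃ A₄ A₅ A₆ A₇ A₈ A₉ A₁₀ X₀ Y₀ Z₀ W₀ M₀ N₀) :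
    (X₀ ≠ 0 ∧ Y₀ ≠ 0) ∨ (X₀ ≠ 0 ∧ Z₀ ≠ 0) ∨ (Y₀ ≠ 0 ∧ Z₀ ≠ 0) := by
  obtain ⟨⟨h₁, h₂⟩, h₃⟩ : (A₁ ≠ 0 ∧ A₂ ≠ 0) ∧ A₃ ≠ 0 := by
    simpa only [mul_ne_zero_iff] using hA
  obtain ⟨hx, hy, hz, -, -, -, hW, hM, hN⟩ := hsol
  by_contra h
  have hzero : (X₀ = 0 ∧ Y₀ = 0) ∨ (X₀ = 0 ∧ Z₀ = 0) ∨ (Y₀ = 0 ∧ Z₀ = 0) := by tauto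
  rcases hzero with ⟨rfl, rfl⟩ | ⟨rfl, rfl⟩ | ⟨rfl, rfl⟩
  all_goals
    obtain rfl : W₀ = 0 := by simpa using hW
    obtain rfl : M₀ = 0 := by simpa using hM
    obtain rfl : N₀ = 0 := by simpa using hN
    simp_all [quadFx, quadFy, quadFz]
end
end

section
/- (Lifting solutions of the cubic to the quadratic system, over any field) Let K be any field and let A₁,…,A₁₀ ∈ ℚ. If (x₀, y₀, z₀) ∈ K³ is a nontrivial solution of F = 0, then (X₀, Y₀, Z₀, W₀, M₀, N₀) = (x₀², y₀², z₀², x₀y₀, x₀z₀, y₀z₀) is a common nontrivial solution in K⁶ of system (3.16). In particular, if F = 0 has nontrivial local solutions in ℚₚ³ for every prime p and in ℝ³, then system (3.16) has common nontrivial solutions in ℚₚ⁶ for every prime p and in ℝ⁶. -/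
noncomputable section

/-- A nontrivial zero of the cubic form maps, under the Veronese embedding of degree two,
to a nontrivial zero of the quadratic system. -/
theorem veronese_sys316 {K : Type*} [Field K] {A₁ A₂ A₃ A₄ A₅ A₆ A₇ A₈ A₉ A₁₀ : ℚ} {x y z : K}
    (hne : x ≠ 0 ∨ y ≠ 0 ∨ z ≠ 0) (hF : cubicF A₁ A₂ A₃ A₄ A₅ A₆ A₇ A₈ A₉ A₁₀ x y z = 0) :
    (x ^ 2 ≠ 0 ∨ y ^ 2 ≠ 0 ∨ z ^ 2 ≠ 0 ∨ x * y ≠ 0 ∨ x * z ≠ 0 ∨ y * z ≠ 0) ∧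
      sys316 A₁ A₂ A₃ A₄ A₅ A₆ A₇ A₈ A₉ A₁₀ (x ^ 2) (y ^ 2) (z ^ 2) (x * y) (x * z) (y * z) := by
  refine ⟨?_, ?_, ?_, ?_, by ring, by ring, by ring, by ring, by ring, by ring⟩
  · rcases hne with h | h | h <;> simp [h]
  · unfold cubicF at hF
    unfold quadFx
    linear_combination x * hF
  · unfold cubicF at hF
    unfold quadFy
    linear_combination y * hF
  · unfold cubicF at hF
    unfold quadFz
    linear_combination z * hF

theorem lift_cubic_to_quadratic_system (A₁ A₂ A₃ A₄ A₅ A₆ A₇ A₈ A₉ A₁₀ : ℚ) :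
    (∀ (K : Type*) [Field K] (x₀ y₀ z₀ : K),
        (x₀ ≠ 0 ∨ y₀ ≠ 0 ∨ z₀ ≠ 0) → cubicF A₁ A₂ A₃ A₄ A₅ A₆ A₇ A₈ A₉ A₁₀ x₀ y₀ z₀ = 0 →
        (x₀ ^ 2 ≠ 0 ∨ y₀ ^ 2 ≠ 0 ∨ z₀ ^ 2 ≠ 0 ∨ x₀ * y₀ ≠ 0 ∨ x₀ * z₀ ≠ 0 ∨ y₀ * z₀ ≠ 0) ∧
          sys316 A₁ A₂ A₃ A₄ A₅ A₆ A₇ A₈ A₉ A₁₀ (x₀ ^ 2) (y₀ ^ 2) (z₀ ^ 2) (x₀ * y₀) (x₀ * z₀) (y₀ * z₀)) ∧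
    ((∀ (p : ℕ) [Fact p.Prime], ∃ x y z : ℚ_[p],
          (x ≠ 0 ∨ y ≠ 0 ∨ z ≠ 0) ∧ cubicF A₁ A₂ A₃ A₄ A₅ A₆ A₇ A₈ A₉ A₁₀ x y z = 0) →
      (∃ x y z : ℝ, (x ≠ 0 ∨ y ≠ 0 ∨ z ≠ 0) ∧ cubicF A₁ A₂ A₃ A₄ A₅ A₆ A₇ A₈ A₉ A₁₀ x y z = 0) →
      (∀ (p : ℕ) [Fact p.Prime], ∃ X Y Z W M N : ℚ_[p],
          (X ≠ 0 ∨ Y ≠ 0 ∨ Z ≠ 0 ∨ W ≠ 0 ∨ M ≠ 0 ∨ N ≠ 0) ∧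
          sys316 A₁ A₂ A₃ A₄ A₅ A₆ A₇ A₈ A₉ A₁₀ X Y Z W M N) ∧
        (∃ X Y Z W M N : ℝ,
          (X ≠ 0 ∨ Y ≠ 0 ∨ Z ≠ 0 ∨ W ≠ 0 ∨ M ≠ 0 ∨ N ≠ 0) ∧
          sys316 A₁ A₂ A₃ A₄ A₅ A₆ A₇ A₈ A₉ A₁₀ X Y Z W M N)) := by
  refine ⟨fun K _ x₀ y₀ z₀ hne hF => veronese_sys316 hne hF, fun hp hr => ⟨fun p _ => ?_, ?_⟩⟩
  · obtain ⟨x, y, z, hne, hF⟩ := hp p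
    exact ⟨_, _, _, _, _, _, veronese_sys316 hne hF⟩
  · obtain ⟨x, y, z, hne, hF⟩ := hr
    exact ⟨_, _, _, _, _, _, veronese_sys316 hne hF⟩
end
end

section
/- (Descent step in the proof of Proposition 3.3) Assume A₁A₂A₃ ≠ 0. If (X₀, Y₀, Z₀, W₀, M₀, N₀) ∈ ℚ⁶ is a common nontrivial rational solution of system (3.16) with X₀ ≠ 0, then (1, W₀/X₀, M₀/X₀) is a nontrivial rational solution of F(x, y, z) = 0. -/
noncomputable section

theorem descent_step_prop_3_3 (A₁ A₂ A₃ A₄ A₅ A₆ A₇ A₈ A₉ A₁₀ : ℚ) (hA : A₁ * A₂ * A₃ ≠ 0)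
    (X₀ Y₀ Z₀ W₀ M₀ N₀ : ℚ)
    (hnt : X₀ ≠ 0 ∨ Y₀ ≠ 0 ∨ Z₀ ≠ 0 ∨ W₀ ≠ 0 ∨ M₀ ≠ 0 ∨ N₀ ≠ 0)
    (hsol : sys316 A₁ A₂ A₃ A₄ A₅ A₆ A₇ A₈ A₉ A₁₀ X₀ Y₀ Z₀ W₀ M₀ N₀) (hX : X₀ ≠ 0) :
    ((1 : ℚ) ≠ 0 ∨ W₀ / X₀ ≠ 0 ∨ M₀ / X₀ ≠ 0) ∧
      cubicF A₁ A₂ A₃ A₄ A₅ A₆ A₇ A₈ A₉ A₁₀ (1 : ℚ) (W₀ / X₀) (M₀ / X₀) = 0 := by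
  obtain ⟨hFx, -, -, hWM, -, -, hW, hM, -⟩ := hsol
  refine ⟨Or.inl one_ne_zero, ?_⟩
  have hY : Y₀ = W₀ ^ 2 / X₀ := by rw [eq_div_iff hX]; linarith
  have hZ : Z₀ = M₀ ^ 2 / X₀ := by rw [eq_div_iff hX]; linarith
  have hN : N₀ = W₀ * M₀ / X₀ := by rw [eq_div_iff hX]; linarith
  have key : quadFx A₁ A₂ A₃ A₄ A₅ A₆ A₇ A₈ A₉ A₁₀ X₀ Y₀ Z₀ W₀ M₀ N₀ =
      X₀ ^ 2 * cubicF A₁ A₂ A₃ A₄ A₅ A₆ A₇ A₈ A₉ A₁₀ (1 : ℚ) (W₀ / X₀) (M₀ / X₀) := by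
    subst hY hZ hN
    unfold quadFx cubicF
    field_simp
  exact (mul_eq_zero.mp (key.symm.trans hFx)).resolve_left (pow_ne_zero 2 hX)
end
end
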